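/- arXiv:1504.04955 — 2 statements merged into one kernel-verified Lean document; each statement's English description precedes it below -/
import Mathlib

section
/- There exists a constant c such that for every n ≥ 2 and all binary strings x, y, z of length at most n, 2·K(x, y, z) ≤ K(x, y) + K(x, z) + K(y, z) + c·log₂ n. -/
/-- Plain Kolmogorov complexity of `x` with respect to decompressor `D`. -/
noncomputable def Kc (D : List Bool →. List Bool) (x : List Bool) : ℕ∞ :=
  sInf {n : ℕ∞ | ∃ p : List Bool, x ∈ D p ∧ (p.length : ℕ∞) = n}

/-- `U` is an optimal decompressor. -/
def OptimalDecompressor (U : List Bool →. List Bool) : Prop :=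
  Partrec U ∧ ∀ D : List Bool →. List Bool, Partrec D →
    ∃ c : ℕ, ∀ x : List Bool, Kc U x ≤ Kc D x + (c : ℕ∞)

open Nat.Partrec (Code)

/-- The discrete Loomis–Whitney inequality in dimension three. -/
theorem card_sq_le_card_image_mul {α β γ : Type*} [DecidableEq α] [DecidableEq β] [DecidableEq γ]
    (S : Finset (α × β × γ)) :
    S.card ^ 2 ≤ (S.image fun s => (s.1, s.2.1)).card * (S.image fun s => (s.1, s.2.2)).card *
      (S.image fun s => s.2).card := by
  set P := S.image fun s => s.2 with hP
  have hfib : S.card = ∑ p ∈ P, (S.filter fun s => s.2 = p).card :=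
    Finset.card_eq_sum_card_fiberwise fun s hs => Finset.mem_image_of_mem _ hs
  have hsq : ∑ p ∈ P, (S.filter fun s => s.2 = p).card ^ 2 ≤
      (S.image fun s => (s.1, s.2.1)).card * (S.image fun s => (s.1, s.2.2)).card := by
    rw [← Finset.card_product]
    have hsigma : ∑ p ∈ P, (S.filter fun s => s.2 = p).card ^ 2 =
        (P.sigma fun p => (S.filter fun s => s.2 = p) ×ˢ (S.filter fun s => s.2 = p)).card := by
      rw [Finset.card_sigma]
      exact Finset.sum_congr rfl fun p _ => by rw [Finset.card_product, sq]
    rw [hsigma]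
    refine Finset.card_le_card_of_injOn
      (fun q => ((q.2.1.1, q.2.1.2.1), (q.2.2.1, q.2.2.2.2))) ?_ ?_
    · rintro ⟨p, s, t⟩ h
      simp only [Finset.coe_sigma, Set.mem_sigma_iff, Finset.mem_coe, Finset.mem_product,
        Finset.mem_filter] at h
      simp only [Finset.mem_coe, Finset.mem_product]
      exact ⟨Finset.mem_image_of_mem (fun s => (s.1, s.2.1)) h.2.1.1,
        Finset.mem_image_of_mem (fun s => (s.1, s.2.2)) h.2.2.1⟩
    · rintro ⟨⟨y, z⟩, ⟨x, s⟩, ⟨x', t⟩⟩ h ⟨⟨y₁, z₁⟩, ⟨x₁, s₁⟩, ⟨x₁', t₁⟩⟩ h' heq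
      simp only [Finset.coe_sigma, Set.mem_sigma_iff, Finset.mem_coe, Finset.mem_product,
        Finset.mem_filter] at h h'
      obtain ⟨-, ⟨-, rfl⟩, -, rfl⟩ := h
      obtain ⟨-, ⟨-, rfl⟩, -, rfl⟩ := h'
      simp only [Prod.mk.injEq] at heq
      obtain ⟨⟨rfl, rfl⟩, rfl, rfl⟩ := heq
      rfl
  calc S.card ^ 2 = (∑ p ∈ P, (S.filter fun s => s.2 = p).card) ^ 2 := by rw [← hfib]
    _ ≤ P.card * ∑ p ∈ P, (S.filter fun s => s.2 = p).card ^ 2 := sq_sum_le_card_mul_sum_sq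
    _ ≤ P.card * _ := Nat.mul_le_mul_left _ hsq
    _ = _ := mul_comm _ _

/-- A finite set of objects all described by programs of length `a` has at most `2 ^ a` elements. -/
theorem card_le_two_pow_of_programs {α : Type*} (D : List Bool →. List Bool) {f : α → List Bool}
    (hf : Function.Injective f) (a : ℕ) (T : Finset α)
    (hT : ∀ t ∈ T, ∃ p : List Bool, p.length = a ∧ f t ∈ D p) : T.card ≤ 2 ^ a := by
  choose! p hp using hT
  have hcard : (Finset.univ : Finset (List.Vector Bool a)).card = 2 ^ a := by
    simp [card_vector]
  rw [← hcard, ← Finset.card_attach]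
  refine Finset.card_le_card_of_injOn (fun t => (⟨p t.1, (hp t.1 t.2).1⟩ : List.Vector Bool a))
    (fun _ _ => Finset.mem_coe.2 (Finset.mem_univ _)) ?_
  rintro ⟨s, hs⟩ - ⟨t, ht⟩ - hst
  have heq : p s = p t := congrArg Subtype.val hst
  exact Subtype.ext (hf (Part.mem_unique (hp s hs).2 (heq ▸ (hp t ht).2)))

/-- A step-bounded computable approximation to a partial recursive function. -/
theorem Partrec.exists_computable_approx {α σ : Type*} [Primcodable α] [Primcodable σ] {f : α →. σ}
    (hf : Partrec f) :
    ∃ g : ℕ → α → Option σ, Computable₂ g ∧ ∀ a b, b ∈ f a ↔ ∃ t, g t a = some b := by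
  obtain ⟨c, hc⟩ := Code.exists_code.1 hf
  refine ⟨fun t a => (Code.evaln t c (Encodable.encode a)).bind Encodable.decode, ?_, ?_⟩
  · refine (Primrec.option_bind (Code.primrec_evaln.comp
      ((Primrec.fst.pair (Primrec.const c)).pair (Primrec.encode.comp Primrec.snd))) ?_).to_comp
    exact Primrec.decode.comp Primrec.snd
  · intro a b
    have hev : Code.eval c (Encodable.encode a) = (f a).map Encodable.encode := by
      rw [hc]; simp
    constructor
    · intro h
      have : Encodable.encode b ∈ Code.eval c (Encodable.encode a) := by
        rw [hev]; exact Part.mem_map _ h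
      obtain ⟨t, ht⟩ := Code.evaln_complete.1 this
      exact ⟨t, Option.bind_eq_some_iff.2 ⟨_, Option.mem_def.1 ht, Encodable.encodek b⟩⟩
    · rintro ⟨t, ht⟩
      obtain ⟨m, hm, hmb⟩ := Option.bind_eq_some_iff.1 ht
      have := Code.evaln_sound (Option.mem_def.2 hm)
      rw [hev] at this
      obtain ⟨b', hb', rfl⟩ := (Part.mem_map_iff _).1 this
      simp only [Encodable.encodek, Option.some.injEq] at hmb
      exact hmb ▸ hb'

/-- The distinct values among the first `m` outputs of the enumeration `r`, in order of
appearance. -/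
def distinctOutputs {β : Type*} [DecidableEq β] (r : ℕ → Option β) : ℕ → List β
  | 0 => []
  | m + 1 => (r m).elim (distinctOutputs r m) fun b =>
      bif (distinctOutputs r m).idxOf b < (distinctOutputs r m).length
      then distinctOutputs r m else distinctOutputs r m ++ [b]

section distinctOutputs

variable {β : Type*} [DecidableEq β] (r : ℕ → Option β)

theorem distinctOutputs_prefix_succ (m : ℕ) :
    distinctOutputs r m <+: distinctOutputs r (m + 1) := by
  rw [distinctOutputs]
  rcases r m with _ | b
  · exact List.prefix_rfl
  · by_cases h : (distinctOutputs r m).idxOf b < (distinctOutputs r m).length <;> simp [h]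

theorem distinctOutputs_prefix_of_le {m m' : ℕ} (h : m ≤ m') :
    distinctOutputs r m <+: distinctOutputs r m' := by
  induction h with
  | refl => exact List.prefix_rfl
  | step _ ih => exact ih.trans (distinctOutputs_prefix_succ r _)

theorem nodup_distinctOutputs (m : ℕ) : (distinctOutputs r m).Nodup := by
  induction m with
  | zero => simp [distinctOutputs]
  | succ m ih =>
    rw [distinctOutputs]
    rcases r m with _ | b
    · exact ih
    · by_cases h : b ∈ distinctOutputs r m
      · simpa [List.idxOf_lt_length_iff, h] using ih
      · simpa [List.idxOf_lt_length_iff, h, List.nodup_append, ih] using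
          fun a ha (hab : a = b) => h (hab ▸ ha)

theorem exists_of_mem_distinctOutputs {m : ℕ} {b : β} (hb : b ∈ distinctOutputs r m) :
    ∃ i, r i = some b := by
  induction m with
  | zero => simp [distinctOutputs] at hb
  | succ m ih =>
    rw [distinctOutputs] at hb
    rcases hr : r m with _ | b'
    · exact ih (by simpa [hr] using hb)
    · by_cases h : b' ∈ distinctOutputs r m
      · exact ih (by simpa [hr, List.idxOf_lt_length_iff, h] using hb)
      · simp only [hr, List.idxOf_lt_length_iff, h, Option.elim, decide_false, cond_false,
          List.mem_append, List.mem_singleton] at hb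
        rcases hb with hb | rfl
        · exact ih hb
        · exact ⟨m, hr⟩

theorem mem_distinctOutputs {m : ℕ} {b : β} (hb : r m = some b) :
    b ∈ distinctOutputs r (m + 1) := by
  rw [distinctOutputs, hb]
  by_cases h : b ∈ distinctOutputs r m <;> simp [List.idxOf_lt_length_iff, h]

end distinctOutputs

theorem computable_distinctOutputs {α β : Type*} [Primcodable α] [Primcodable β] [DecidableEq β]
    {r : α → ℕ → Option β} (hr : Computable₂ r) :
    Computable₂ fun a m => distinctOutputs (r a) m := by
  have hstep : Computable₂ fun (L : List β) (b : β) =>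
      bif L.idxOf b < L.length then L else L ++ [b] := by
    refine (Primrec.cond ?_ Primrec.fst ?_).to_comp
    · exact (Primrec.nat_lt.comp (Primrec.list_idxOf.comp Primrec.snd Primrec.fst)
        (Primrec.list_length.comp Primrec.fst)).decide
    · exact Primrec.list_concat.comp Primrec.fst Primrec.snd
  have hrec : Computable fun q : α × ℕ => (Nat.rec [] (fun m L => (r q.1 m).elim L fun b =>
      bif L.idxOf b < L.length then L else L ++ [b]) q.2 : List β) := by
    refine Computable.nat_rec (h := fun q s => (r q.1 s.1).elim s.2 fun b =>
      bif s.2.idxOf b < s.2.length then s.2 else s.2 ++ [b])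
      Computable.snd (Computable.const []) ?_
    refine (Computable.option_casesOn (σ := List β)
      (o := fun q : (α × ℕ) × ℕ × List β => r q.1.1 q.2.1)
      (g := fun q b => bif q.2.2.idxOf b < q.2.2.length then q.2.2 else q.2.2 ++ [b])
      (hr.comp (Computable.fst.comp Computable.fst) (Computable.fst.comp Computable.snd))
      (Computable.snd.comp Computable.snd)
      (hstep.comp (Computable.snd.comp (Computable.snd.comp Computable.fst))
        Computable.snd)).of_eq fun q => ?_
    rcases h : r q.1.1 q.2.1 with _ | b <;> simp only [h] <;> rfl
  refine hrec.of_eq fun ⟨a, m⟩ => ?_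
  induction m with
  | zero => rfl
  | succ m ih => simp only [distinctOutputs] at ih ⊢; rw [← ih]

/-- Elements of a uniformly enumerable family of sets can be computed from the parameter and an
ordinal number in an enumeration without repetitions. -/
theorem exists_partrec_enumeration {α β : Type*} [Primcodable α] [Primcodable β] [DecidableEq β]
    {r : α → ℕ → Option β} (hr : Computable₂ r) :
    ∃ G : α × ℕ →. β, Partrec G ∧ ∀ a b, (∃ m, r a m = some b) →
      ∃ k, b ∈ G (a, k) ∧ ∃ S : Finset β, k < S.card ∧ ∀ s ∈ S, ∃ m, r a m = some s := by
  refine ⟨fun q => Nat.rfindOpt fun m => (distinctOutputs (r q.1) m)[q.2]?, ?_, ?_⟩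
  · refine Partrec.rfindOpt (f := fun (q : α × ℕ) m => (distinctOutputs (r q.1) m)[q.2]?) ?_
    exact Computable.list_getElem?.comp
      ((computable_distinctOutputs hr).comp (Computable.fst.comp Computable.fst) Computable.snd)
      (Computable.snd.comp Computable.fst)
  · rintro a b ⟨m, hm⟩
    obtain ⟨k, hk, hkb⟩ := List.getElem_of_mem (mem_distinctOutputs (r a) hm)
    refine ⟨k, ?_, (distinctOutputs (r a) (m + 1)).toFinset, ?_, ?_⟩
    · refine (Nat.rfindOpt_mono ?_).2 ⟨m + 1, ?_⟩
      · intro b m m' hmm h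
        obtain ⟨L, hL⟩ := distinctOutputs_prefix_of_le (r a) hmm
        obtain ⟨hk', -⟩ := List.getElem?_eq_some_iff.1 h
        exact Option.mem_def.2
          (by rw [← hL, List.getElem?_append_left hk', ← Option.mem_def]; exact h)
      · exact List.getElem?_eq_some_iff.2 ⟨hk, hkb⟩
    · rwa [List.toFinset_card_of_nodup (nodup_distinctOutputs _ _)]
    · intro s hs
      exact exists_of_mem_distinctOutputs _ (List.mem_toFinset.1 hs)

/-- The self-delimiting concatenation of two strings. -/
def selfDelimAppend (u v : List Bool) : List Bool :=
  List.replicate u.length true ++ false :: (u ++ v)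

/-- Recovers both strings from their self-delimiting concatenation. -/
def selfDelimSplit (p : List Bool) : List Bool × List Bool :=
  let k := (p.takeWhile id).length
  ((p.drop (k + 1)).take k, (p.drop (k + 1)).drop k)

theorem length_selfDelimAppend (u v : List Bool) :
    (selfDelimAppend u v).length = 2 * u.length + 1 + v.length := by
  simp [selfDelimAppend]; ring

theorem selfDelimSplit_append (u v : List Bool) :
    selfDelimSplit (selfDelimAppend u v) = (u, v) := by
  have h : ((selfDelimAppend u v).takeWhile id).length = u.length := by
    rw [selfDelimAppend, List.takeWhile_append_of_pos (by simp)]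
    simp
  have h' : (selfDelimAppend u v).drop (u.length + 1) = u ++ v := by
    simp [selfDelimAppend, List.drop_append]
  simp [selfDelimSplit, h, h']

theorem primrec_selfDelimSplit : Primrec selfDelimSplit := by
  have hk : Primrec fun p : List Bool => (p.takeWhile id).length :=
    Primrec.list_length.comp (Primrec.list_takeWhile Primrec.id)
  have hd : Primrec fun p : List Bool => p.drop ((p.takeWhile id).length + 1) :=
    Primrec.list_drop.comp (Primrec.succ.comp hk) Primrec.id
  exact (Primrec.list_take.comp hk hd).pair (Primrec.list_drop.comp hk hd)

/-- The number with the given binary digits, least significant first. -/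
def natOfBits (l : List Bool) : ℕ := l.foldr (fun b n => bif b then 2 * n + 1 else 2 * n) 0

theorem natOfBits_bits (n : ℕ) : natOfBits n.bits = n := by
  induction n using Nat.binaryRec' with
  | zero => rfl
  | bit b n h ih =>
    rw [Nat.bits_append_bit _ _ h, natOfBits, List.foldr_cons]
    change (bif b then 2 * natOfBits n.bits + 1 else 2 * natOfBits n.bits) = _
    rw [ih]; cases b <;> simp [Nat.bit]

theorem primrec_natOfBits : Primrec natOfBits := by
  refine Primrec.list_foldr (h := fun _ s => bif s.1 then 2 * s.2 + 1 else 2 * s.2)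
    Primrec.id (Primrec.const 0) ?_
  have h2 : Primrec fun q : List Bool × Bool × ℕ => q.2.2 := Primrec.snd.comp Primrec.snd
  exact Primrec.cond (Primrec.fst.comp Primrec.snd) (Primrec.nat_double_succ.comp h2)
    (Primrec.nat_double.comp h2)

theorem Kc_le_length {D : List Bool →. List Bool} {x p : List Bool} (h : x ∈ D p) :
    Kc D x ≤ p.length :=
  sInf_le ⟨p, h, rfl⟩

theorem exists_program_of_Kc_le {D : List Bool →. List Bool} {x : List Bool} {N : ℕ}
    (h : Kc D x ≤ N) : ∃ p, x ∈ D p ∧ (p.length : ℕ∞) = Kc D x ∧ p.length ≤ N := by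
  have hne : {n : ℕ∞ | ∃ p : List Bool, x ∈ D p ∧ (p.length : ℕ∞) = n}.Nonempty := by
    by_contra! hempty
    rw [Kc, hempty, sInf_empty] at h
    exact absurd h (by simp)
  obtain ⟨p, hp, hl⟩ := csInf_mem hne
  refine ⟨p, hp, hl, ?_⟩
  change (p.length : ℕ∞) = Kc D x at hl
  rw [← hl] at h
  exact_mod_cast h

/-- The complexity of a pair is at most linear in the lengths of its components. -/
theorem exists_Kc_pair_le {U : List Bool →. List Bool} (hU : OptimalDecompressor U)
    {pair : List Bool × List Bool → List Bool} (hpair : Computable pair) :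
    ∃ c : ℕ, ∀ x y : List Bool,
      Kc U (pair (x, y)) ≤ ((2 * x.length + 1 + y.length + c : ℕ) : ℕ∞) := by
  obtain ⟨c, hc⟩ := hU.2 (fun p => Part.some (pair (selfDelimSplit p)))
    (hpair.comp primrec_selfDelimSplit.to_comp).partrec
  refine ⟨c, fun x y => (hc _).trans ?_⟩
  rw [Nat.cast_add _ c, ← length_selfDelimAppend]
  gcongr
  exact Kc_le_length (by simp [selfDelimSplit_append])

/-- Whether a string has a program of a given length is semidecidable: it is witnessed by a
computably checkable certificate. -/
theorem exists_computable_certificate {U : List Bool →. List Bool} (hU : Partrec U) {α : Type*}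
    [Primcodable α] {f : α → List Bool} (hf : Computable f) :
    ∃ check : (ℕ × ℕ × List Bool) × α → Bool, Computable check ∧
      ∀ a u, (∃ w, check ((a, w), u) = true) ↔ ∃ p : List Bool, p.length = a ∧ f u ∈ U p := by
  obtain ⟨g, hg, hgU⟩ := hU.exists_computable_approx
  have hp : Primrec fun q : (ℕ × ℕ × List Bool) × α => q.1.2.2 :=
    Primrec.snd.comp (Primrec.snd.comp Primrec.fst)
  have ht : Primrec fun q : (ℕ × ℕ × List Bool) × α => q.1.2.1 :=
    Primrec.fst.comp (Primrec.snd.comp Primrec.fst)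
  have ha : Primrec fun q : (ℕ × ℕ × List Bool) × α => q.1.1 := Primrec.fst.comp Primrec.fst
  have hlen : Computable fun q : (ℕ × ℕ × List Bool) × α => decide (q.1.2.2.length = q.1.1) :=
    (Primrec.eq.comp (Primrec.list_length.comp hp) ha).decide.to_comp
  have hrun : Computable fun q : (ℕ × ℕ × List Bool) × α => g q.1.2.1 q.1.2.2 :=
    hg.comp ht.to_comp hp.to_comp
  have hout : Computable fun q : (ℕ × ℕ × List Bool) × α => some (f q.2) :=
    Computable.option_some.comp (hf.comp Computable.snd)
  have heq : Computable fun q : (ℕ × ℕ × List Bool) × α =>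
      decide (g q.1.2.1 q.1.2.2 = some (f q.2)) :=
    (Primrec.eq (α := Option (List Bool))).decide.to_comp.comp hrun hout
  refine ⟨fun q => decide (q.1.2.2.length = q.1.1) && decide (g q.1.2.1 q.1.2.2 = some (f q.2)),
    Primrec.and.to_comp.comp hlen heq, fun a u => ?_⟩
  simp only [hgU, Bool.and_eq_true, decide_eq_true_eq]
  constructor
  · rintro ⟨⟨t, p⟩, h, h'⟩
    exact ⟨p, h, t, h'⟩
  · rintro ⟨p, h, t, h'⟩
    exact ⟨(t, p), h, h'⟩

/-- Triples all of whose pairs have certificates are uniformly enumerable. -/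
theorem exists_computable_enum_of_certificate {ι ω α : Type*} [Primcodable ι] [Primcodable ω]
    [Primcodable α] {check : (ι × ω) × α × α → Bool} (hcheck : Computable check) :
    ∃ r : ι × ι × ι → ℕ → Option (α × α × α), Computable₂ r ∧
      ∀ a b c x y z, (∃ m, r (a, b, c) m = some (x, y, z)) ↔
        (∃ w, check ((a, w), x, y) = true) ∧ (∃ w, check ((b, w), x, z) = true) ∧
          ∃ w, check ((c, w), y, z) = true := by
  let Q := (ι × ι × ι) × (α × α × α) × ω × ω × ω
  have hx : Primrec fun q : Q => q.2.1.1 := Primrec.fst.comp (Primrec.fst.comp Primrec.snd)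
  have hyz : Primrec fun q : Q => q.2.1.2 := Primrec.snd.comp (Primrec.fst.comp Primrec.snd)
  have hw : Primrec fun q : Q => q.2.2 := Primrec.snd.comp Primrec.snd
  have hy : Primrec fun q : Q => q.2.1.2.1 := Primrec.fst.comp hyz
  have hz : Primrec fun q : Q => q.2.1.2.2 := Primrec.snd.comp hyz
  have h₁ : Computable fun q : Q => check ((q.1.1, q.2.2.1), q.2.1.1, q.2.1.2.1) :=
    hcheck.comp (((Primrec.fst.comp Primrec.fst).pair (Primrec.fst.comp hw)).pair
      (hx.pair hy)).to_comp
  have h₂ : Computable fun q : Q => check ((q.1.2.1, q.2.2.2.1), q.2.1.1, q.2.1.2.2) :=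
    hcheck.comp (((Primrec.fst.comp (Primrec.snd.comp Primrec.fst)).pair
      (Primrec.fst.comp (Primrec.snd.comp hw))).pair (hx.pair hz)).to_comp
  have h₃ : Computable fun q : Q => check ((q.1.2.2, q.2.2.2.2), q.2.1.2.1, q.2.1.2.2) :=
    hcheck.comp (((Primrec.snd.comp (Primrec.snd.comp Primrec.fst)).pair
      (Primrec.snd.comp (Primrec.snd.comp hw))).pair (hy.pair hz)).to_comp
  let checkAll : Q → Bool := fun q =>
    check ((q.1.1, q.2.2.1), q.2.1.1, q.2.1.2.1) &&
      (check ((q.1.2.1, q.2.2.2.1), q.2.1.1, q.2.1.2.2) &&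
        check ((q.1.2.2, q.2.2.2.2), q.2.1.2.1, q.2.1.2.2))
  have hcheckAll : Computable checkAll :=
    Primrec.and.to_comp.comp h₁ (Primrec.and.to_comp.comp h₂ h₃)
  refine ⟨fun a m => (Encodable.decode (α := (α × α × α) × ω × ω × ω) m).bind fun d =>
    bif checkAll (a, d) then some d.1 else none, ?_, ?_⟩
  · refine Computable.option_bind (Computable.decode.comp Computable.snd) ?_
    refine Computable.cond (hcheckAll.comp
      ((Computable.fst.comp Computable.fst).pair Computable.snd)) ?_ (Computable.const none)
    exact Computable.option_some.comp (Computable.fst.comp Computable.snd)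
  · intro a b c x y z
    constructor
    · rintro ⟨m, hm⟩
      obtain ⟨⟨t, w₁, w₂, w₃⟩, -, h⟩ := Option.bind_eq_some_iff.1 hm
      cases hch : checkAll ((a, b, c), t, w₁, w₂, w₃) with
      | false => simp [hch] at h
      | true =>
        simp only [hch, cond_true, Option.some.injEq] at h
        subst h
        simp only [checkAll, Bool.and_eq_true] at hch
        exact ⟨⟨_, hch.1⟩, ⟨_, hch.2.1⟩, ⟨_, hch.2.2⟩⟩
    · rintro ⟨⟨w₁, h₁⟩, ⟨w₂, h₂⟩, w₃, h₃⟩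
      refine ⟨Encodable.encode (((x, y, z), w₁, w₂, w₃) : (α × α × α) × ω × ω × ω), ?_⟩
      simp [checkAll, h₁, h₂, h₃]

/-- The triples whose three pairs have programs of prescribed lengths are uniformly enumerable. -/
theorem exists_computable_enum_triples {U : List Bool →. List Bool} (hU : Partrec U)
    {pair : List Bool × List Bool → List Bool} (hpair : Computable pair) :
    ∃ r : ℕ × ℕ × ℕ → ℕ → Option (List Bool × List Bool × List Bool), Computable₂ r ∧
      ∀ a b c x y z, (∃ m, r (a, b, c) m = some (x, y, z)) ↔
        (∃ p : List Bool, p.length = a ∧ pair (x, y) ∈ U p) ∧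
        (∃ p : List Bool, p.length = b ∧ pair (x, z) ∈ U p) ∧
        (∃ p : List Bool, p.length = c ∧ pair (y, z) ∈ U p) := by
  obtain ⟨check, hcheck, hcheck_iff⟩ := exists_computable_certificate hU hpair
  simp only [← hcheck_iff]
  exact exists_computable_enum_of_certificate hcheck

theorem two_mul_size_le_of_sq_lt {k e : ℕ} (h : k ^ 2 < 2 ^ e) : 2 * k.size ≤ e + 2 := by
  rcases hs : k.size with _ | s
  · omega
  · have hk : 2 ^ s ≤ k := Nat.lt_size.1 (by omega)
    have : 2 ^ (2 * s) < 2 ^ e := by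
      calc 2 ^ (2 * s) = (2 ^ s) ^ 2 := by rw [← pow_mul, mul_comm]
        _ ≤ k ^ 2 := Nat.pow_le_pow_left hk 2
        _ < 2 ^ e := h
    have := (Nat.pow_lt_pow_iff_right (by norm_num : 1 < 2)).1 this
    omega

/-- A triple is described by the lengths of programs for its pairs together with about half of the
sum of these lengths in additional bits. -/
theorem exists_Kc_triple_le {U : List Bool →. List Bool} (hU : OptimalDecompressor U)
    {pair : List Bool × List Bool → List Bool} (hpair : Computable pair)
    (hinj : Function.Injective pair) :
    ∃ C : ℕ, ∀ x y z p q r : List Bool,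
      pair (x, y) ∈ U p → pair (x, z) ∈ U q → pair (y, z) ∈ U r →
      2 * Kc U (pair (x, pair (y, z))) ≤ ((p.length + q.length + r.length +
        4 * (Nat.pair p.length (Nat.pair q.length r.length)).size + C : ℕ) : ℕ∞) := by
  obtain ⟨e, he, he_iff⟩ := exists_computable_enum_triples hU.1 hpair
  obtain ⟨G, hG, hGe⟩ := exists_partrec_enumeration he
  let params : List Bool → (ℕ × ℕ × ℕ) × ℕ := fun s =>
    (((natOfBits (selfDelimSplit s).1).unpair.1,
      (natOfBits (selfDelimSplit s).1).unpair.2.unpair), natOfBits (selfDelimSplit s).2)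
  have hparams : Primrec params := by
    have h₁ : Primrec fun s => (natOfBits (selfDelimSplit s).1).unpair :=
      Primrec.unpair.comp (primrec_natOfBits.comp (Primrec.fst.comp primrec_selfDelimSplit))
    exact ((Primrec.fst.comp h₁).pair (Primrec.unpair.comp (Primrec.snd.comp h₁))).pair
      (primrec_natOfBits.comp (Primrec.snd.comp primrec_selfDelimSplit))
  obtain ⟨c, hc⟩ := hU.2 (fun s => (G (params s)).map fun t => pair (t.1, pair t.2)) <| by
    refine (hG.comp hparams.to_comp).map ?_
    exact hpair.comp ((Computable.fst.comp Computable.snd).pair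
      (hpair.comp (Computable.snd.comp Computable.snd)))
  refine ⟨2 * c + 4, fun x y z p q r hp hq hr => ?_⟩
  obtain ⟨k, hk, S, hkS, hS⟩ := hGe (p.length, q.length, r.length) (x, y, z)
    ((he_iff _ _ _ _ _ _).2 ⟨⟨p, rfl, hp⟩, ⟨q, rfl, hq⟩, ⟨r, rfl, hr⟩⟩)
  have hk2 : k ^ 2 < 2 ^ (p.length + q.length + r.length) := by
    calc k ^ 2 < S.card ^ 2 := Nat.pow_lt_pow_left hkS (by norm_num)
      _ ≤ _ := card_sq_le_card_image_mul S
      _ ≤ 2 ^ p.length * 2 ^ q.length * 2 ^ r.length := by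
        gcongr <;> refine card_le_two_pow_of_programs U hinj _ _ fun t ht => ?_
        all_goals
          obtain ⟨⟨x', y', z'⟩, hs, rfl⟩ := Finset.mem_image.1 ht
          have := (he_iff _ _ _ _ _ _).1 (hS _ hs)
        exacts [this.1, this.2.1, this.2.2]
      _ = _ := by rw [← pow_add, ← pow_add]
  have hsize := two_mul_size_le_of_sq_lt hk2
  set m := Nat.pair p.length (Nat.pair q.length r.length) with hm
  have hprog : pair (x, pair (y, z)) ∈ (G (params (selfDelimAppend m.bits k.bits))).map
      fun t => pair (t.1, pair t.2) := by
    have : params (selfDelimAppend m.bits k.bits) = ((p.length, q.length, r.length), k) := by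
      simp [params, selfDelimSplit_append, natOfBits_bits, hm]
    rw [this]
    exact Part.mem_map (fun t : _ × _ × _ => pair (t.1, pair t.2)) hk
  have hKc : Kc U (pair (x, pair (y, z))) ≤ ((2 * m.size + 1 + k.size + c : ℕ) : ℕ∞) := by
    refine (hc _).trans ?_
    rw [Nat.cast_add _ c, ← Nat.size_eq_bits_len m, ← Nat.size_eq_bits_len k,
      ← length_selfDelimAppend]
    gcongr
    exact Kc_le_length hprog
  calc 2 * Kc U (pair (x, pair (y, z))) ≤ 2 * ((2 * m.size + 1 + k.size + c : ℕ) : ℕ∞) := by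
        gcongr
    _ = ((2 * (2 * m.size + 1 + k.size + c) : ℕ) : ℕ∞) := by push_cast; rfl
    _ ≤ _ := by exact_mod_cast (by omega)

theorem size_pair_pair_le {a b c M s : ℕ} (ha : a ≤ M) (hb : b ≤ M) (hc : c ≤ M)
    (hM : M + 2 ≤ 2 ^ s) : (Nat.pair a (Nat.pair b c)).size ≤ 4 * s := by
  rw [Nat.size_le]
  have h₁ : Nat.pair b c < (M + 1) ^ 2 :=
    (Nat.pair_lt_max_add_one_sq b c).trans_le (Nat.pow_le_pow_left (by omega) 2)
  have h₂ : max a (Nat.pair b c) + 1 ≤ (M + 2) ^ 2 := by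
    have : max a (Nat.pair b c) ≤ (M + 1) ^ 2 := max_le (by nlinarith) h₁.le
    nlinarith
  calc Nat.pair a (Nat.pair b c) < (max a (Nat.pair b c) + 1) ^ 2 :=
        Nat.pair_lt_max_add_one_sq _ _
    _ ≤ ((M + 2) ^ 2) ^ 2 := Nat.pow_le_pow_left h₂ 2
    _ = (M + 2) ^ 4 := by ring
    _ ≤ (2 ^ s) ^ 4 := Nat.pow_le_pow_left hM 4
    _ = 2 ^ (4 * s) := by rw [← pow_mul, mul_comm]

/-- For strings `x, y, z` of length at most `n` (`n ≥ 2`):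
`2·K(x, y, z) ≤ K(x, y) + K(x, z) + K(y, z) + c·log₂ n`, where
`K(x, y) = K([x, y])` and `K(x, y, z) = K([x, [y, z]])` for a fixed computable
injective pairing. -/
theorem double_triple_inequality
    (U : List Bool →. List Bool) (hU : OptimalDecompressor U)
    (pair : List Bool × List Bool → List Bool)
    (hpair : Computable pair) (hinj : Function.Injective pair) :
    ∃ c : ℕ, ∀ n : ℕ, 2 ≤ n → ∀ x y z : List Bool,
      x.length ≤ n → y.length ≤ n → z.length ≤ n →
      2 * Kc U (pair (x, pair (y, z))) ≤
        Kc U (pair (x, y)) + Kc U (pair (x, z)) + Kc U (pair (y, z)) +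
          ((c * Nat.log 2 n : ℕ) : ℕ∞) := by
  obtain ⟨d, hd⟩ := exists_Kc_pair_le hU hpair
  obtain ⟨C, hC⟩ := exists_Kc_triple_le hU hpair hinj
  refine ⟨C + 16 * (d + 6), fun n hn x y z hx hy hz => ?_⟩
  have hbound : ∀ u v : List Bool, u.length ≤ n → v.length ≤ n →
      Kc U (pair (u, v)) ≤ ((3 * n + 1 + d : ℕ) : ℕ∞) := fun u v hu hv =>
    (hd u v).trans (by exact_mod_cast (by omega))
  obtain ⟨p, hp, hpK, hpn⟩ := exists_program_of_Kc_le (hbound x y hx hy)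
  obtain ⟨q, hq, hqK, hqn⟩ := exists_program_of_Kc_le (hbound x z hx hz)
  obtain ⟨r, hr, hrK, hrn⟩ := exists_program_of_Kc_le (hbound y z hy hz)
  have hlog : 1 ≤ Nat.log 2 n := Nat.log_pos (by norm_num) hn
  have hpow : 3 * n + 1 + d + 2 ≤ 2 ^ (d + 5 + Nat.log 2 n) := by
    have h₁ : n < 2 ^ (Nat.log 2 n + 1) := Nat.lt_pow_succ_log_self (by norm_num) n
    have h₂ : d < 2 ^ d := Nat.lt_two_pow_self
    have h₃ : 2 ^ (d + 5 + Nat.log 2 n) = 16 * (2 ^ d * 2 ^ (Nat.log 2 n + 1)) := by ring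
    rw [h₃]
    nlinarith [Nat.mul_le_mul (Nat.succ_le_of_lt h₂) (Nat.succ_le_of_lt h₁)]
  have hsize := size_pair_pair_le hpn hqn hrn hpow
  refine (hC x y z p q r hp hq hr).trans ?_
  rw [← hpK, ← hqK, ← hrK]
  have hfinal : 4 * (Nat.pair p.length (Nat.pair q.length r.length)).size + C ≤
      (C + 16 * (d + 6)) * Nat.log 2 n := by
    nlinarith [Nat.mul_le_mul_left (C + 16 * (d + 5)) hlog]
  exact_mod_cast (by omega)
end

section
/- There exists a maximal lower semicomputable semimeasure: a lower semicomputable semimeasure m : ℕ → ℝ such that for every lower semicomputable semimeasure m' there is a constant c > 0 with m'(i) ≤ c·m(i) for all i ∈ ℕ. -/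
open Filter

/-- `m : ℕ → ℝ` is a lower semicomputable semimeasure: it is nonnegative, its
sum is at most `1` (stated via finite partial sums), and it is the pointwise
limit of a computable nondecreasing (in the second argument) family of
nonnegative rationals. -/
def LscSemimeasure (m : ℕ → ℝ) : Prop :=
  (∀ i, 0 ≤ m i) ∧
  (∀ F : Finset ℕ, ∑ i ∈ F, m i ≤ 1) ∧
  (∃ q : ℕ × ℕ → ℚ, Computable q ∧
    (∀ i n, 0 ≤ q (i, n)) ∧
    (∀ i n, q (i, n) ≤ q (i, n + 1)) ∧
    (∀ i, Tendsto (fun n => (q (i, n) : ℝ)) atTop (nhds (m i))))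

open Encodable

theorem Computable.of_graph {α β : Type*} [Primcodable α] [Denumerable β] {f : α → β}
    {p : α → β → Bool} (hp : Computable₂ p) (h : ∀ a b, p a b = true ↔ b = f a) :
    Computable f := by
  have hp' : Computable₂ fun (a : α) (n : ℕ) => p a (Denumerable.ofNat β n) :=
    hp.comp Computable.fst ((Computable.ofNat β).comp Computable.snd)
  refine ((Partrec.rfind hp'.partrec₂).map
    ((Computable.ofNat β).comp Computable.snd).to₂).of_eq_tot fun a => ?_
  obtain ⟨n, hn, -⟩ := Nat.rfind_min' (p := fun n => p a (Denumerable.ofNat β n))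
    (m := encode (f a)) (by simp [h])
  refine (Part.mem_map_iff _).2 ⟨n, hn, ?_⟩
  have := Nat.rfind_spec hn
  exact (h a _).1 (by simpa using this)

theorem Primrec.nat_gcd : Primrec₂ Nat.gcd := by
  have hdvd : PrimrecRel fun (a : ℕ × ℕ) (x : ℕ) => a.1 % x = 0 ∧ a.2 % x = 0 :=
    PrimrecPred.and
      (Primrec.eq.comp (Primrec.nat_mod.comp (Primrec.fst.comp Primrec.fst) Primrec.snd)
        (Primrec.const 0))
      (Primrec.eq.comp (Primrec.nat_mod.comp (Primrec.snd.comp Primrec.fst) Primrec.snd)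
        (Primrec.const 0))
  refine (Primrec.nat_findGreatest (Primrec.nat_add.comp Primrec.fst Primrec.snd) hdvd).of_eq ?_
  rintro ⟨a, b⟩
  have hle : Nat.gcd a b ≤ a + b := by
    rcases Nat.eq_zero_or_pos a with rfl | ha
    · simp
    · exact (Nat.gcd_le_left b ha).trans (Nat.le_add_right a b)
  have hgcd : a % Nat.gcd a b = 0 ∧ b % Nat.gcd a b = 0 :=
    ⟨Nat.mod_eq_zero_of_dvd (Nat.gcd_dvd_left a b), Nat.mod_eq_zero_of_dvd (Nat.gcd_dvd_right a b)⟩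
  have hspec := Nat.findGreatest_spec (P := fun x => a % x = 0 ∧ b % x = 0) hle hgcd
  have hge := Nat.le_findGreatest (P := fun x => a % x = 0 ∧ b % x = 0) hle hgcd
  rcases Nat.eq_zero_or_pos (Nat.gcd a b) with h0 | h0
  · obtain ⟨rfl, rfl⟩ := Nat.gcd_eq_zero_iff.1 h0
    rfl
  · exact le_antisymm (Nat.le_of_dvd h0 (Nat.dvd_gcd (Nat.dvd_of_mod_eq_zero hspec.1)
      (Nat.dvd_of_mod_eq_zero hspec.2))) hge

theorem Primrec.nat_count {p : ℕ → Prop} [DecidablePred p] (hp : PrimrecPred p) :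
    Primrec (Nat.count p) :=
  (Primrec.nat_rec₁ 0 (Primrec.nat_add.comp Primrec.snd
    (Primrec.ite (hp.comp Primrec.fst) (Primrec.const 1) (Primrec.const 0))).to₂).of_eq fun n => by
    induction n with
    | zero => simp
    | succ n ih => simp [Nat.count_succ, ← ih]

theorem Int.encode_ofNat (n : ℕ) : encode (n : ℤ) = 2 * n := rfl

theorem Int.encode_negSucc (n : ℕ) : encode (Int.negSucc n) = 2 * n + 1 := rfl

theorem Int.natAbs_eq_encode_add_one_div_two (a : ℤ) : a.natAbs = (encode a + 1) / 2 := by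
  rcases a with n | n
  · rw [Int.ofNat_eq_natCast, Int.encode_ofNat, Int.natAbs_natCast]; omega
  · rw [Int.encode_negSucc, Int.natAbs_negSucc]; omega

namespace Rat

/-- The code of a rational as the pair of its numerator and denominator; the numbering of `ℚ`
enumerates these codes in increasing order. -/
def pairCode (r : ℚ) : ℕ := Nat.pair (encode r.num) r.den

/-- The predicate that a number is the pair code of a rational in lowest terms. -/
def IsPairCode (k : ℕ) : Prop := 0 < k.unpair.2 ∧ ((k.unpair.1 + 1) / 2).gcd k.unpair.2 = 1

instance : DecidablePred IsPairCode := fun k => by unfold IsPairCode; infer_instance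

theorem isPairCode_pairCode (r : ℚ) : IsPairCode r.pairCode := by
  simpa [IsPairCode, pairCode, ← Int.natAbs_eq_encode_add_one_div_two] using ⟨r.pos, r.reduced⟩

theorem IsPairCode.exists_eq {k : ℕ} (hk : IsPairCode k) : ∃ r : ℚ, r.pairCode = k := by
  have h : (Denumerable.ofNat ℤ k.unpair.1).natAbs = (k.unpair.1 + 1) / 2 := by
    rw [Int.natAbs_eq_encode_add_one_div_two]
    exact congrArg (fun n => (n + 1) / 2) (Denumerable.encode_ofNat (α := ℤ) _)
  refine ⟨⟨Denumerable.ofNat ℤ k.unpair.1, k.unpair.2, hk.1.ne', ?_⟩, ?_⟩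
  · rw [h]; exact hk.2
  · rw [pairCode]
    conv_rhs => rw [← Nat.pair_unpair k]
    congr 1
    exact Denumerable.encode_ofNat (α := ℤ) _

theorem encode_eq_count (r : ℚ) :
    @encode ℚ Primcodable.toEncodable r = Nat.count IsPairCode r.pairCode := by
  have h : ∀ k, k ∈ Set.range (@encode ℚ Rat.instEncodable) ↔ IsPairCode k := fun k =>
    ⟨by rintro ⟨r, rfl⟩; exact isPairCode_pairCode r, fun hk => hk.exists_eq⟩
  have e : @encode ℚ Primcodable.toEncodable r =
      @Nat.count (· ∈ Set.range (@encode ℚ Rat.instEncodable))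
        (@decidableRangeEncode ℚ Rat.instEncodable) r.pairCode := rfl
  rw [e]
  simp only [Nat.count_eq_card_filter_range, h]

theorem primrecPred_isPairCode : PrimrecPred IsPairCode := by
  have h₁ : Primrec fun k : ℕ => k.unpair.1 := Primrec.fst.comp Primrec.unpair
  have h₂ : Primrec fun k : ℕ => k.unpair.2 := Primrec.snd.comp Primrec.unpair
  exact (Primrec.nat_lt.comp (Primrec.const 0) h₂).and
    (Primrec.eq.comp (Primrec.nat_gcd.comp
      (Primrec.nat_div.comp (Primrec.succ.comp h₁) (Primrec.const 2)) h₂) (Primrec.const 1))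

theorem computable_pairCode : Computable pairCode := by
  have hp : PrimrecPred fun x : ℚ × ℕ =>
      IsPairCode x.2 ∧ Nat.count IsPairCode x.2 = @encode ℚ Primcodable.toEncodable x.1 :=
    (primrecPred_isPairCode.comp Primrec.snd).and
      (Primrec.eq.comp ((Primrec.nat_count primrecPred_isPairCode).comp Primrec.snd)
        (Primrec.encode.comp Primrec.fst))
  refine Computable.of_graph (Primrec.to_comp hp.decide).to₂ fun r k => ?_
  rw [decide_eq_true_iff, encode_eq_count]
  constructor
  · rintro ⟨hk, h⟩
    exact Nat.count_injective hk (isPairCode_pairCode r) h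
  · rintro rfl
    exact ⟨isPairCode_pairCode r, rfl⟩

theorem computable_den : Computable Rat.den :=
  (Computable.snd.comp (Computable.unpair.comp computable_pairCode)).of_eq fun r => by
    simp [pairCode]

theorem computable_encode_num : Computable fun r : ℚ => encode r.num :=
  (Computable.fst.comp (Computable.unpair.comp computable_pairCode)).of_eq fun r => by
    simp [pairCode]

theorem computable_toNat_num : Computable fun r : ℚ => r.num.toNat := by
  have h : Primrec fun n : ℕ => if n % 2 = 0 then n / 2 else 0 :=
    Primrec.ite (Primrec.eq.comp (Primrec.nat_mod.comp Primrec.id (Primrec.const 2))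
      (Primrec.const 0)) (Primrec.nat_div.comp Primrec.id (Primrec.const 2)) (Primrec.const 0)
  refine (h.to_comp.comp computable_encode_num).of_eq fun r => ?_
  rcases r.num with n | n
  · rw [Int.ofNat_eq_natCast, Int.encode_ofNat]; simp
  · rw [Int.encode_negSucc]; simp

theorem computable_toNat_neg_num : Computable fun r : ℚ => (-r.num).toNat := by
  have h : Primrec fun n : ℕ => if n % 2 = 0 then 0 else (n + 1) / 2 :=
    Primrec.ite (Primrec.eq.comp (Primrec.nat_mod.comp Primrec.id (Primrec.const 2))
      (Primrec.const 0)) (Primrec.const 0)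
      (Primrec.nat_div.comp (Primrec.succ.comp Primrec.id) (Primrec.const 2))
  refine (h.to_comp.comp computable_encode_num).of_eq fun r => ?_
  rcases r.num with n | n
  · rw [Int.ofNat_eq_natCast, Int.encode_ofNat]; simp
  · rw [Int.encode_negSucc]; simp; omega

end Rat

namespace Rat

theorem eq_toNat_sub_div_den (r : ℚ) :
    r = ((r.num.toNat : ℚ) - ((-r.num).toNat : ℚ)) / (r.den : ℚ) := by
  conv_lhs => rw [← Rat.num_div_den r]
  congr 1
  exact_mod_cast (Int.toNat_sub_toNat_neg r.num).symm

theorem eq_add_iff_nat (r s t : ℚ) :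
    t = r + s ↔ r.num.toNat * s.den * t.den + s.num.toNat * r.den * t.den +
        (-t.num).toNat * r.den * s.den =
      t.num.toNat * r.den * s.den + (-r.num).toNat * s.den * t.den +
        (-s.num).toNat * r.den * t.den := by
  have hr : (r.den : ℚ) ≠ 0 := Nat.cast_ne_zero.2 r.den_nz
  have hs : (s.den : ℚ) ≠ 0 := Nat.cast_ne_zero.2 s.den_nz
  have ht : (t.den : ℚ) ≠ 0 := Nat.cast_ne_zero.2 t.den_nz
  rw [← Nat.cast_inj (R := ℚ)]
  conv_lhs => rw [eq_toNat_sub_div_den r, eq_toNat_sub_div_den s, eq_toNat_sub_div_den t,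
    div_add_div _ _ hr hs, div_eq_div_iff ht (mul_ne_zero hr hs)]
  push_cast
  constructor <;> intro h <;> linear_combination -h

theorem le_iff_nat (r s : ℚ) :
    r ≤ s ↔ r.num.toNat * s.den + (-s.num).toNat * r.den ≤
      s.num.toNat * r.den + (-r.num).toNat * s.den := by
  have hr : (0 : ℚ) < r.den := Nat.cast_pos.2 r.pos
  have hs : (0 : ℚ) < s.den := Nat.cast_pos.2 s.pos
  rw [← Nat.cast_le (α := ℚ)]
  conv_lhs => rw [eq_toNat_sub_div_den r, eq_toNat_sub_div_den s, div_le_div_iff₀ hr hs]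
  push_cast
  constructor <;> intro h <;> linarith

end Rat

namespace Computable

variable {α : Type*} [Primcodable α] {f g : α → ℚ}

theorem nat_mul {f g : α → ℕ} (hf : Computable f) (hg : Computable g) :
    Computable fun a => f a * g a :=
  Primrec.nat_mul.to_comp.comp hf hg

theorem nat_add {f g : α → ℕ} (hf : Computable f) (hg : Computable g) :
    Computable fun a => f a + g a :=
  Primrec.nat_add.to_comp.comp hf hg

theorem rat_add (hf : Computable f) (hg : Computable g) : Computable fun a => f a + g a := by
  have hf' := hf.comp (Computable.fst (α := α) (β := ℚ))
  have hg' := hg.comp (Computable.fst (α := α) (β := ℚ))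
  have ht : Computable fun x : α × ℚ => x.2 := Computable.snd
  have num {h : α × ℚ → ℚ} (hh : Computable h) := Rat.computable_toNat_num.comp hh
  have neg {h : α × ℚ → ℚ} (hh : Computable h) := Rat.computable_toNat_neg_num.comp hh
  have den {h : α × ℚ → ℚ} (hh : Computable h) := Rat.computable_den.comp hh
  refine Computable.of_graph (p := fun _ _ => decide _) (Computable.to₂ <|
    (PrimrecRel.decide (Primrec.eq (α := ℕ))).to_comp.comp
      ((((num hf').nat_mul (den hg')).nat_mul (den ht)).nat_add
        (((num hg').nat_mul (den hf')).nat_mul (den ht)) |>.nat_add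
        (((neg ht).nat_mul (den hf')).nat_mul (den hg')))
      ((((num ht).nat_mul (den hf')).nat_mul (den hg')).nat_add
        (((neg hf').nat_mul (den hg')).nat_mul (den ht)) |>.nat_add
        (((neg hg').nat_mul (den hf')).nat_mul (den ht)))) fun a t => ?_
  rw [decide_eq_true_iff, Rat.eq_add_iff_nat]

theorem rat_le (hf : Computable f) (hg : Computable g) :
    Computable fun a => decide (f a ≤ g a) := by
  have num {h : α → ℚ} (hh : Computable h) := Rat.computable_toNat_num.comp hh
  have neg {h : α → ℚ} (hh : Computable h) := Rat.computable_toNat_neg_num.comp hh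
  have den {h : α → ℚ} (hh : Computable h) := Rat.computable_den.comp hh
  refine ((PrimrecRel.decide Primrec.nat_le).to_comp.comp
    (((num hf).nat_mul (den hg)).nat_add ((neg hg).nat_mul (den hf)))
    (((num hg).nat_mul (den hf)).nat_add ((neg hf).nat_mul (den hg)))).of_eq fun a => ?_
  rw [decide_eq_decide, Rat.le_iff_nat]

theorem ite {σ : Type*} [Primcodable σ] {c : α → Prop} [DecidablePred c] {f g : α → σ}
    (hc : Computable fun a => decide (c a)) (hf : Computable f) (hg : Computable g) :
    Computable fun a => if c a then f a else g a :=
  (Computable.cond hc hf hg).of_eq fun a => by by_cases h : c a <;> simp [h]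

theorem rat_max (hf : Computable f) (hg : Computable g) : Computable fun a => max (f a) (g a) :=
  (Computable.ite (rat_le hf hg) hg hf).of_eq fun _ => (max_def _ _).symm

theorem rat_half (hf : Computable f) : Computable fun a => f a / 2 := by
  have ht : Computable fun x : α × ℚ => x.2 := Computable.snd
  refine Computable.of_graph (p := fun a t => decide (t + t = f a)) (Computable.to₂ <|
    (PrimrecRel.decide (Primrec.eq (α := ℚ))).to_comp.comp (rat_add ht ht)
      (hf.comp Computable.fst)) fun a t => ?_
  rw [decide_eq_true_iff, eq_div_iff two_ne_zero, mul_two]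

theorem rat_div_two_pow (hf : Computable f) {n : α → ℕ} (hn : Computable n) :
    Computable fun a => f a / 2 ^ n a :=
  (Computable.nat_rec (h := fun _ x => x.2 / 2) hn hf
    (rat_half (Computable.snd.comp Computable.snd)).to₂).of_eq fun a => by
    induction n a with
    | zero => simp
    | succ n ih => simp only [ih, pow_succ, div_div]

theorem rat_sum_range {f : α → ℕ → ℚ} (hf : Computable₂ f) {n : α → ℕ} (hn : Computable n) :
    Computable fun a => ∑ i ∈ Finset.range (n a), f a i :=
  (Computable.nat_rec (h := fun a x => x.2 + f a x.1) hn (Computable.const 0)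
    (rat_add (Computable.snd.comp Computable.snd)
      (hf.comp Computable.fst (Computable.fst.comp Computable.snd))).to₂).of_eq fun a => by
    induction n a with
    | zero => simp
    | succ n ih => simp only [ih, Finset.sum_range_succ]

end Computable

/-- The maximum of `0` and the values of `f` below `n`. -/
def runMax (f : ℕ → ℚ) : ℕ → ℚ
  | 0 => 0
  | n + 1 => max (runMax f n) (f n)

theorem runMax_mono (f : ℕ → ℚ) : Monotone (runMax f) :=
  monotone_nat_of_le_succ fun _ => le_max_left _ _

theorem runMax_nonneg (f : ℕ → ℚ) (n : ℕ) : 0 ≤ runMax f n :=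
  runMax_mono f n.zero_le

theorem le_runMax (f : ℕ → ℚ) {s n : ℕ} (h : s < n) : f s ≤ runMax f n :=
  (le_max_right _ _).trans (runMax_mono f (Nat.succ_le_of_lt h))

theorem runMax_le {f : ℕ → ℚ} {b : ℝ} (hb : 0 ≤ b) (h : ∀ s, (f s : ℝ) ≤ b) (n : ℕ) :
    (runMax f n : ℝ) ≤ b := by
  induction n with
  | zero => simpa [runMax] using hb
  | succ n ih => rw [runMax, Rat.cast_max]; exact max_le ih (h n)

theorem Computable.runMax {α : Type*} [Primcodable α] {f : α → ℕ → ℚ} (hf : Computable₂ f)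
    {n : α → ℕ} (hn : Computable n) : Computable fun a => runMax (f a) (n a) :=
  (Computable.nat_rec (h := fun a x => max x.2 (f a x.1)) hn (Computable.const 0)
    (rat_max (Computable.snd.comp Computable.snd)
      (hf.comp Computable.fst (Computable.fst.comp Computable.snd))).to₂).of_eq fun a => by
    induction n a with
    | zero => rfl
    | succ n ih => simp only [ih, _root_.runMax]

/-- The finitely supported approximation at stage `n` to the pointwise supremum of `u`. -/
def stage (u : ℕ → ℕ → ℚ) (n i : ℕ) : ℚ := if i < n then runMax (u i) n else 0

theorem stage_nonneg (u : ℕ → ℕ → ℚ) (n i : ℕ) : 0 ≤ stage u n i := by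
  unfold stage
  split_ifs
  exacts [runMax_nonneg _ _, le_rfl]

theorem stage_mono (u : ℕ → ℕ → ℚ) (i : ℕ) : Monotone fun n => stage u n i := by
  intro n k h
  by_cases hi : i < n
  · simpa [stage, hi, hi.trans_le h] using runMax_mono (u i) h
  · simpa [stage, hi] using stage_nonneg u k i

theorem sum_stage_le (u : ℕ → ℕ → ℚ) (n : ℕ) (F : Finset ℕ) :
    ∑ i ∈ F, stage u n i ≤ ∑ i ∈ Finset.range n, stage u n i := by
  rw [← Finset.sum_filter_add_sum_filter_not F (· < n)]
  rw [Finset.sum_eq_zero (s := F.filter (¬ · < n)), add_zero]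
  · exact Finset.sum_le_sum_of_subset_of_nonneg (fun i hi => by simp_all)
      fun i _ _ => stage_nonneg u n i
  · intro i hi
    simp only [Finset.mem_filter] at hi
    simp [stage, hi.2]

/-- The last approximation before stage `n` whose total mass is at most `1`. -/
def trimmed (u : ℕ → ℕ → ℚ) : ℕ → ℕ → ℚ
  | 0, _ => 0
  | n + 1, i => if ∑ j ∈ Finset.range n, stage u n j ≤ 1 then stage u n i else trimmed u n i

theorem trimmed_le_stage (u : ℕ → ℕ → ℚ) (n i : ℕ) : trimmed u n i ≤ stage u n i := by
  induction n with
  | zero => exact stage_nonneg u 0 i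
  | succ n ih =>
    have h : stage u n i ≤ stage u (n + 1) i := stage_mono u i n.le_succ
    rw [trimmed]
    split_ifs
    exacts [h, ih.trans h]

theorem trimmed_mono (u : ℕ → ℕ → ℚ) (i : ℕ) : Monotone fun n => trimmed u n i := by
  refine monotone_nat_of_le_succ fun n => ?_
  rw [trimmed]
  split_ifs
  exacts [trimmed_le_stage u n i, le_rfl]

theorem trimmed_nonneg (u : ℕ → ℕ → ℚ) (n i : ℕ) : 0 ≤ trimmed u n i :=
  trimmed_mono u i n.zero_le

theorem sum_trimmed_le_one (u : ℕ → ℕ → ℚ) (n : ℕ) (F : Finset ℕ) :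
    ∑ i ∈ F, trimmed u n i ≤ 1 := by
  induction n with
  | zero => simp [trimmed]
  | succ n ih =>
    simp only [trimmed]
    split_ifs with h
    exacts [(sum_stage_le u n F).trans h, ih]

/-- The mixture of the trimmed families `u e` with weights `2 ^ (-(e + 1))`. -/
def mixture (u : ℕ → ℕ → ℕ → ℚ) (n i : ℕ) : ℚ :=
  ∑ e ∈ Finset.range n, trimmed (u e) n i / 2 ^ (e + 1)

theorem mixture_nonneg (u : ℕ → ℕ → ℕ → ℚ) (n i : ℕ) : 0 ≤ mixture u n i :=
  Finset.sum_nonneg fun _ _ => div_nonneg (trimmed_nonneg _ _ _) (by positivity)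

theorem mixture_mono (u : ℕ → ℕ → ℕ → ℚ) (i : ℕ) : Monotone fun n => mixture u n i := by
  intro n k h
  refine (Finset.sum_le_sum fun e _ => ?_).trans (Finset.sum_le_sum_of_subset_of_nonneg
    (Finset.range_subset_range.2 h) fun e _ _ => div_nonneg (trimmed_nonneg _ _ _) (by positivity))
  exact div_le_div_of_nonneg_right (trimmed_mono (u e) i h) (by positivity)

theorem sum_mixture_le_one (u : ℕ → ℕ → ℕ → ℚ) (n : ℕ) (F : Finset ℕ) :
    ∑ i ∈ F, mixture u n i ≤ 1 := by
  have hgeom : ∑ e ∈ Finset.range n, (1 : ℚ) / 2 ^ (e + 1) = 1 - 1 / 2 ^ n := by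
    induction n with
    | zero => simp
    | succ n ih => rw [Finset.sum_range_succ, ih, pow_succ]; field_simp; ring
  calc ∑ i ∈ F, mixture u n i
      = ∑ e ∈ Finset.range n, (∑ i ∈ F, trimmed (u e) n i) / 2 ^ (e + 1) := by
        simp only [mixture, Finset.sum_div]; exact Finset.sum_comm
    _ ≤ ∑ e ∈ Finset.range n, (1 : ℚ) / 2 ^ (e + 1) := Finset.sum_le_sum fun e _ =>
        div_le_div_of_nonneg_right (sum_trimmed_le_one (u e) n F) (by positivity)
    _ ≤ 1 := by rw [hgeom]; exact sub_le_self _ (by positivity)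

theorem trimmed_div_le_mixture (u : ℕ → ℕ → ℕ → ℚ) {e n : ℕ} (h : e < n) (i : ℕ) :
    trimmed (u e) n i / 2 ^ (e + 1) ≤ mixture u n i :=
  Finset.single_le_sum (f := fun e => trimmed (u e) n i / 2 ^ (e + 1))
    (fun _ _ => div_nonneg (trimmed_nonneg _ _ _) (by positivity)) (Finset.mem_range.2 h)

/-- If `u` is bounded by a semimeasure, then trimming has no effect. -/
theorem trimmed_succ_eq_stage {u : ℕ → ℕ → ℚ} {b : ℕ → ℝ} (hb : ∀ i, 0 ≤ b i)
    (hsum : ∀ F : Finset ℕ, ∑ i ∈ F, b i ≤ 1) (hu : ∀ i s, (u i s : ℝ) ≤ b i) (n i : ℕ) :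
    trimmed u (n + 1) i = stage u n i := by
  rw [trimmed, if_pos]
  have h : ((∑ j ∈ Finset.range n, stage u n j : ℚ) : ℝ) ≤ 1 := by
    rw [Rat.cast_sum]
    refine (Finset.sum_le_sum fun j _ => ?_).trans (hsum (Finset.range n))
    unfold stage
    split_ifs
    · exact runMax_le (hb j) (hu j) n
    · simpa using hb j
  exact_mod_cast h

theorem computable_stage {α : Type*} [Primcodable α] {u : α → ℕ → ℕ → ℚ}
    (hu : Computable fun x : α × ℕ × ℕ => u x.1 x.2.1 x.2.2) {n i : α → ℕ}
    (hn : Computable n) (hi : Computable i) : Computable fun a => stage (u a) (n a) (i a) :=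
  Computable.ite ((PrimrecRel.decide Primrec.nat_lt).to_comp.comp hi hn)
    (Computable.runMax (hu.comp (Computable.fst.pair
      ((hi.comp Computable.fst).pair Computable.snd))).to₂ hn) (Computable.const 0)

theorem computable_trimmed {α : Type*} [Primcodable α] {u : α → ℕ → ℕ → ℚ}
    (hu : Computable fun x : α × ℕ × ℕ => u x.1 x.2.1 x.2.2) {n i : α → ℕ}
    (hn : Computable n) (hi : Computable i) : Computable fun a => trimmed (u a) (n a) (i a) := by
  have hk : Computable fun x : α × ℕ × ℚ => x.2.1 := Computable.fst.comp Computable.snd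
  have hsum : Computable fun x : α × ℕ × ℚ =>
      ∑ j ∈ Finset.range x.2.1, stage (u x.1) x.2.1 j := by
    have hg : Computable fun y : ((α × ℕ × ℚ) × ℕ) × ℕ × ℕ => (y.1.1.1, y.2) :=
      ((Computable.fst.comp Computable.fst).comp Computable.fst).pair Computable.snd
    have hst : Computable fun y : (α × ℕ × ℚ) × ℕ => stage (u y.1.1) y.1.2.1 y.2 :=
      computable_stage (u := fun y : (α × ℕ × ℚ) × ℕ => u y.1.1)
        (hu.comp hg :) (hk.comp Computable.fst) Computable.snd
    exact Computable.rat_sum_range hst.to₂ hk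
  have hst : Computable fun x : α × ℕ × ℚ => stage (u x.1) x.2.1 (i x.1) := by
    have hg : Computable fun y : (α × ℕ × ℚ) × ℕ × ℕ => (y.1.1, y.2) :=
      (Computable.fst.comp Computable.fst).pair Computable.snd
    exact computable_stage (u := fun x : α × ℕ × ℚ => u x.1) (hu.comp hg :) hk
      (hi.comp Computable.fst)
  have hstep : Computable fun x : α × ℕ × ℚ =>
      if ∑ j ∈ Finset.range x.2.1, stage (u x.1) x.2.1 j ≤ 1
      then stage (u x.1) x.2.1 (i x.1) else x.2.2 :=
    Computable.ite (Computable.rat_le hsum (Computable.const 1)) hst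
      (Computable.snd.comp Computable.snd)
  refine (Computable.nat_rec hn (Computable.const (0 : ℚ)) hstep.to₂).of_eq fun a => ?_
  induction n a with
  | zero => rfl
  | succ n ih => simp only [ih, trimmed]

theorem computable_mixture {u : ℕ → ℕ → ℕ → ℚ}
    (hu : Computable fun x : ℕ × ℕ × ℕ => u x.1 x.2.1 x.2.2) :
    Computable fun x : ℕ × ℕ => mixture u x.2 x.1 := by
  have htrim : Computable fun y : (ℕ × ℕ) × ℕ => trimmed (u y.2) y.1.2 y.1.1 := by
    refine computable_trimmed (u := fun y : (ℕ × ℕ) × ℕ => u y.2) ?_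
      (Computable.snd.comp Computable.fst) (Computable.fst.comp Computable.fst)
    have hpair : Computable fun x : ((ℕ × ℕ) × ℕ) × ℕ × ℕ => (x.1.2, x.2) :=
      (Computable.snd.comp Computable.fst).pair Computable.snd
    exact (hu.comp hpair :)
  exact Computable.rat_sum_range
    (Computable.rat_div_two_pow htrim (Computable.succ.comp Computable.snd)).to₂ Computable.snd

/-- The value found by running the `e`-th code on `(i, k)` for `t` steps, where `s` codes `(t, k)`;
it is `0` if no rational is output. -/
def universalRat (e i s : ℕ) : ℚ :=
  ((Nat.Partrec.Code.evaln s.unpair.1 (Denumerable.ofNat Nat.Partrec.Code e)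
    (Nat.pair i s.unpair.2)).map (Denumerable.ofNat ℚ)).getD 0

theorem computable_universalRat :
    Computable fun x : ℕ × ℕ × ℕ => universalRat x.1 x.2.1 x.2.2 := by
  have hs : Computable fun x : ℕ × ℕ × ℕ => x.2.2.unpair :=
    Computable.unpair.comp (Computable.snd.comp Computable.snd)
  have ht : Computable fun x : ℕ × ℕ × ℕ => x.2.2.unpair.1 := Computable.fst.comp hs
  have hc : Computable fun x : ℕ × ℕ × ℕ => Denumerable.ofNat Nat.Partrec.Code x.1 :=
    (Computable.ofNat Nat.Partrec.Code).comp Computable.fst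
  have hn : Computable fun x : ℕ × ℕ × ℕ => Nat.pair x.2.1 x.2.2.unpair.2 :=
    Primrec₂.natPair.to_comp.comp (Computable.fst.comp Computable.snd) (Computable.snd.comp hs)
  have hev : Computable fun x : ℕ × ℕ × ℕ => Nat.Partrec.Code.evaln x.2.2.unpair.1
      (Denumerable.ofNat Nat.Partrec.Code x.1) (Nat.pair x.2.1 x.2.2.unpair.2) :=
    (Nat.Partrec.Code.primrec_evaln.to_comp.comp ((ht.pair hc).pair hn) :)
  have hof : Computable₂ fun (_ : ℕ × ℕ × ℕ) (y : ℕ) => Denumerable.ofNat ℚ y :=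
    ((Computable.ofNat ℚ).comp Computable.snd).to₂
  have hmap := Computable.option_map hev hof
  exact (Computable.option_getD hmap (Computable.const (0 : ℚ)) :)

theorem exists_universalRat_eq {q : ℕ × ℕ → ℚ} (hq : Computable q) :
    ∃ e, (∀ i s, universalRat e i s = 0 ∨ ∃ k, universalRat e i s = q (i, k)) ∧
      ∀ i k, ∃ s, universalRat e i s = q (i, k) := by
  have hp : Computable fun n : ℕ => @encode ℚ Primcodable.toEncodable (q n.unpair) :=
    Computable.encode.comp (hq.comp Computable.unpair)
  obtain ⟨c, hc⟩ := Nat.Partrec.Code.exists_code.1 (Partrec.nat_iff.1 hp.partrec)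
  have heval (n x : ℕ) : x ∈ c.eval n ↔ x = @encode ℚ Primcodable.toEncodable (q n.unpair) := by
    rw [hc]; exact Part.mem_some_iff
  refine ⟨encode c, fun i s => ?_, fun i k => ?_⟩
  · rw [universalRat, Denumerable.ofNat_encode]
    rcases h : Nat.Partrec.Code.evaln s.unpair.1 c (Nat.pair i s.unpair.2) with _ | x
    · exact Or.inl rfl
    · refine Or.inr ⟨s.unpair.2, ?_⟩
      obtain rfl := (heval _ _).1 (Nat.Partrec.Code.evaln_sound h)
      exact (Denumerable.ofNat_encode (α := ℚ) _).trans (by rw [Nat.unpair_pair])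
  · obtain ⟨t, ht⟩ := Nat.Partrec.Code.evaln_complete.1 ((heval (Nat.pair i k) _).2 rfl)
    refine ⟨Nat.pair t k, ?_⟩
    rw [universalRat, Denumerable.ofNat_encode, Nat.unpair_pair, Option.mem_def.1 ht]
    exact (Denumerable.ofNat_encode (α := ℚ) _).trans (by rw [Nat.unpair_pair])

/-- There exists a maximal lower semicomputable semimeasure. -/
theorem exists_maximal_lsc_semimeasure :
    ∃ m : ℕ → ℝ, LscSemimeasure m ∧
      ∀ m' : ℕ → ℝ, LscSemimeasure m' →
        ∃ c : ℝ, 0 < c ∧ ∀ i : ℕ, m' i ≤ c * m i := by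
  have hmono (i : ℕ) : Monotone fun n => (mixture universalRat n i : ℝ) := fun n k h =>
    Rat.cast_le.2 (mixture_mono universalRat i h)
  have hsum (F : Finset ℕ) (n : ℕ) : ∑ i ∈ F, (mixture universalRat n i : ℝ) ≤ 1 := by
    exact_mod_cast sum_mixture_le_one universalRat n F
  have hbdd (i : ℕ) : BddAbove (Set.range fun n => (mixture universalRat n i : ℝ)) :=
    ⟨1, by rintro _ ⟨n, rfl⟩; simpa using hsum {i} n⟩
  have htend (i : ℕ) := tendsto_atTop_ciSup (hmono i) (hbdd i)
  refine ⟨fun i => ⨆ n, (mixture universalRat n i : ℝ),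
    ⟨fun i => ?_, fun F => ?_, fun x => mixture universalRat x.2 x.1,
      computable_mixture computable_universalRat, fun i n => mixture_nonneg _ _ _,
      fun i n => mixture_mono _ _ n.le_succ, htend⟩, ?_⟩
  · exact Real.iSup_nonneg fun n => Rat.cast_nonneg.2 (mixture_nonneg _ _ _)
  · exact le_of_tendsto' (tendsto_finsetSum F fun i _ => htend i) (hsum F)
  · rintro m' ⟨hm', hm'sum, q, hq, -, hqmono, hqtend⟩
    obtain ⟨e, he, he'⟩ := exists_universalRat_eq hq
    have hqle (i k : ℕ) : (q (i, k) : ℝ) ≤ m' i :=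
      (monotone_nat_of_le_succ fun n => Rat.cast_le.2 (hqmono i n)).ge_of_tendsto (hqtend i) k
    have hu (i s : ℕ) : (universalRat e i s : ℝ) ≤ m' i := by
      rcases he i s with h | ⟨k, h⟩
      · simpa [h] using hm' i
      · simpa [h] using hqle i k
    refine ⟨2 ^ (e + 1), by positivity, fun i => le_of_tendsto' (hqtend i) fun k => ?_⟩
    obtain ⟨s, hs⟩ := he' i k
    obtain ⟨n, hen, hin, hsn⟩ : ∃ n, e ≤ n ∧ i < n ∧ s < n :=
      ⟨e + i + s + 1, by omega, by omega, by omega⟩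
    have h₁ : q (i, k) ≤ trimmed (universalRat e) (n + 1) i := by
      rw [trimmed_succ_eq_stage hm' hm'sum hu, stage, if_pos hin, ← hs]
      exact le_runMax (universalRat e i) hsn
    have h₂ : q (i, k) / 2 ^ (e + 1) ≤ mixture universalRat (n + 1) i :=
      (div_le_div_of_nonneg_right h₁ (by positivity)).trans
        (trimmed_div_le_mixture universalRat (Nat.lt_succ_of_le hen) i)
    have h₃ : (q (i, k) : ℝ) / 2 ^ (e + 1) ≤ mixture universalRat (n + 1) i := by
      exact_mod_cast h₂
    rw [mul_comm, ← div_le_iff₀ (by positivity)]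
    exact h₃.trans (le_ciSup (hbdd i) (n + 1))
end
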